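/- FC(3,6) = 4: every family of 4 distinct 3-element subsets of [6] generates a Frankl-Complete family, and there exists a family of 3 distinct 3-element subsets of [6] whose generated union-closed family is Non–Frankl-Complete. -/

import Mathlib

/-- A family of sets is union-closed. -/
def UC (F : Finset (Finset ℕ)) : Prop := ∀ A ∈ F, ∀ B ∈ F, A ∪ B ∈ F

/-- `famU F` is the union `U(F)` of all members of the family `F`. -/
def famU (F : Finset (Finset ℕ)) : Finset ℕ := F.sup id

/-- `memFam F i` is the subfamily `F_i` of sets in `F` containing `i`. -/
def memFam (F : Finset (Finset ℕ)) (i : ℕ) : Finset (Finset ℕ) :=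
  F.filter (fun S => i ∈ S)

/-- `A` is Frankl-Complete: every union-closed family containing `A` has an
element of `U(A)` belonging to at least half of its sets. -/
def FC (A : Finset (Finset ℕ)) : Prop :=
  ∀ F : Finset (Finset ℕ), UC F → A ⊆ F →
    ∃ i ∈ famU A, 2 * (memFam F i).card ≥ F.card

/-- `A` is Non–Frankl-Complete: some union-closed family containing `A` has every
element of `U(A)` in fewer than half of its sets. -/
def NonFC (A : Finset (Finset ℕ)) : Prop :=
  ∃ F : Finset (Finset ℕ), UC F ∧ A ⊆ F ∧
    ∀ i ∈ famU A, 2 * (memFam F i).card < F.card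

/-- `gen S` is the union-closed family generated by `S`: the smallest
union-closed family containing `S`, given explicitly as all unions of
nonempty subfamilies of `S`. -/
def gen (S : Finset (Finset ℕ)) : Finset (Finset ℕ) :=
  (S.powerset.filter (fun T => T.Nonempty)).image (fun T => T.sup id)

/-- `n` points with positive integer weights `c`, masks `A` of the generating sets, and the tables of
those masks whose signed weight is positive, respectively negative, with its absolute value. -/
structure Data where
  n : ℕ
  c : List ℕ
  A : List ℕ
  pos : List (ℕ × ℕ)
  neg : List (ℕ × ℕ)

/-- Evaluate `n` to a numeral before passing it on to `k`. -/
def force {α : Type} (n : ℕ) (k : ℕ → α) : α :=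
  Nat.rec (motive := fun _ => α) (k 0) (fun m _ => k (Nat.succ m)) n

theorem force_eq {α : Type} (n : ℕ) (k : ℕ → α) : force n k = k n := by
  cases n <;> rfl

/-- Bit `i` of a mask below 64, as `2 ^ i`, with the set of masks below 64 having that bit. -/
def bitCols : List (ℕ × ℕ) :=
  [(1, 12297829382473034410), (2, 14757395258967641292), (4, 17361641481138401520),
   (8, 18374966859414961920), (16, 18446462603027742720), (32, 18446744069414584320)]

/-- Add the bits of `h` listed in the given part of `bitCols` to all members of the family `F`. -/
def orShiftAux (h : ℕ) : List (ℕ × ℕ) → ℕ → ℕ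
  | [], F => F
  | (b, M) :: l, F =>
    bif Nat.beq (Nat.land h b) 0 then orShiftAux h l F
    else force (Nat.land (Nat.lor F (Nat.shiftLeft F b)) M) (orShiftAux h l)

/-- `h ∪ ·` applied to all members of the family `F` of masks. -/
def orShift (h F : ℕ) : ℕ := orShiftAux h bitCols F

/-- Total of the table `l` over the members of `P`. -/
def score (l : List (ℕ × ℕ)) (P : ℕ) : ℕ :=
  l.foldr (fun x acc => Nat.add (Nat.mul (Nat.land (Nat.shiftRight P x.1) 1) x.2) acc) 0

/-- Branch on the membership of each mask in the given list. `F` consists of masks known to be members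
and `P` of `F` together with the undecided masks of negative weight. -/
def search (pos neg : List (ℕ × ℕ)) (G : ℕ) : List (ℕ × ℕ) → ℕ → ℕ → Bool
  | [], _, P => Nat.ble (score neg P) (score pos P)
  | h :: t, F, P =>
    bif Nat.ble (score neg P) (score pos P) then true
    else bif Nat.beq (Nat.land (Nat.shiftRight F h.1) 1) 0 then
      force (Nat.xor P (Nat.shiftLeft 1 h.1)) (search pos neg G t F) &&
      force (Nat.lor F (orShift h.1 (Nat.lor F G))) fun N =>
        force (Nat.lor P N) (search pos neg G t N)
    else search pos neg G t F P

/-- The family of all unions of masks in `A`. -/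
def genBits (A : List ℕ) : ℕ := A.foldr (fun a G => Nat.lor G (orShift a G)) 1

/-- The family of masks listed in `neg`. -/
def negBits (neg : List (ℕ × ℕ)) : ℕ := neg.foldr (fun h P => Nat.lor P (Nat.shiftLeft 1 h.1)) 0

/-- Entry of the table `l` at `m`. -/
def tab (l : List (ℕ × ℕ)) (m : ℕ) : ℕ := ((l.filter (fun x => x.1 = m)).map (·.2)).sum

/-- Weight of the mask `m` minus the weight of its complement. -/
def signed (n : ℕ) (c : List ℕ) (m : ℕ) : ℤ :=
  ∑ i ∈ Finset.range n, (c.getD i 0 : ℤ) * (if m.testBit i then 1 else -1)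

/-- The signed weight of every family closed under unions, also with the sets in `d.A`, is
nonnegative; decided by a search. -/
def Data.check (d : Data) : Bool :=
  force (genBits d.A) fun G => force (negBits d.neg) fun P => search d.pos d.neg G d.neg 0 P

/-- The tables of `d` agree with its weights. -/
def Data.Valid (d : Data) : Prop :=
  d.n ≤ 6 ∧ 0 < d.n ∧ (∀ i < d.n, 0 < d.c.getD i 0) ∧ (∀ a ∈ d.A, a < 2 ^ d.n) ∧
    (∀ x ∈ d.neg, (tab d.pos x.1 : ℤ) - tab d.neg x.1 < 0 ∧ x.1 < 64) ∧
    (∀ m < 2 ^ d.n, (tab d.pos m : ℤ) - tab d.neg m = signed d.n d.c m)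

instance (d : Data) : Decidable d.Valid := by unfold Data.Valid; infer_instance

/-- Weights and generators of the `star` configuration. -/
def starData : Data where
  n := 4
  c := [1, 1, 1, 1]
  A := [7, 11, 13]
  pos :=
   [(7, 2), (11, 2), (13, 2), (14, 2), (15, 4)]
  neg :=
   [(0, 4), (1, 2), (2, 2), (4, 2), (8, 2)]

/-- Weights and generators of the `sunflower` configuration. -/
def sunflowerData : Data where
  n := 5
  c := [3, 3, 2, 2, 2]
  A := [7, 11, 19]
  pos :=
   [(7, 4), (11, 4), (13, 2), (14, 2), (15, 8), (19, 4), (21, 2), (22, 2), (23, 8), (25, 2),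
    (26, 2), (27, 8), (29, 6), (30, 6), (31, 12)]
  neg :=
   [(0, 12), (4, 8), (8, 8), (16, 8), (1, 6), (2, 6), (12, 4), (20, 4), (24, 4), (5, 2), (6, 2),
    (9, 2), (10, 2), (17, 2), (18, 2)]

/-- Weights and generators of the `path` configuration. -/
def pathData : Data where
  n := 5
  c := [2, 3, 4, 3, 2]
  A := [7, 14, 28]
  pos :=
   [(7, 4), (11, 2), (13, 4), (14, 6), (15, 10), (21, 2), (22, 4), (23, 8), (26, 2), (27, 6),
    (28, 4), (29, 8), (30, 10), (31, 14)]
  neg :=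
   [(0, 14), (1, 10), (16, 10), (2, 8), (8, 8), (4, 6), (17, 6), (3, 4), (9, 4), (18, 4), (24, 4),
    (5, 2), (10, 2), (20, 2)]

/-- Weights and generators of the `fork` configuration. -/
def forkData : Data where
  n := 5
  c := [3, 3, 4, 4, 2]
  A := [7, 11, 28]
  pos :=
   [(7, 4), (11, 4), (13, 6), (14, 6), (15, 12), (21, 2), (22, 2), (23, 8), (25, 2), (26, 2),
    (27, 8), (28, 4), (29, 10), (30, 10), (31, 16)]
  neg :=
   [(0, 16), (16, 12), (1, 10), (2, 10), (4, 8), (8, 8), (17, 6), (18, 6), (3, 4), (20, 4),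
    (24, 4), (5, 2), (6, 2), (9, 2), (10, 2)]

/-- Weights and generators of the `tetra` configuration. -/
def tetraData : Data where
  n := 6
  c := [1, 1, 1, 1, 1, 1]
  A := [7, 25, 42, 52]
  pos :=
   [(15, 2), (23, 2), (27, 2), (29, 2), (30, 2), (31, 4), (39, 2), (43, 2), (45, 2), (46, 2),
    (47, 4), (51, 2), (53, 2), (54, 2), (55, 4), (57, 2), (58, 2), (59, 4), (60, 2), (61, 4),
    (62, 4), (63, 6)]
  neg :=
   [(0, 6), (1, 4), (2, 4), (4, 4), (8, 4), (16, 4), (32, 4), (3, 2), (5, 2), (6, 2), (9, 2),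
    (10, 2), (12, 2), (17, 2), (18, 2), (20, 2), (24, 2), (33, 2), (34, 2), (36, 2), (40, 2),
    (48, 2)]

/-- Weights and generators of the `cycle` configuration. -/
def cycleData : Data where
  n := 6
  c := [1, 1, 1, 1, 1, 1]
  A := [7, 11, 52, 56]
  pos :=
   [(15, 2), (23, 2), (27, 2), (29, 2), (30, 2), (31, 4), (39, 2), (43, 2), (45, 2), (46, 2),
    (47, 4), (51, 2), (53, 2), (54, 2), (55, 4), (57, 2), (58, 2), (59, 4), (60, 2), (61, 4),
    (62, 4), (63, 6)]
  neg :=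
   [(0, 6), (32, 4), (16, 4), (8, 4), (4, 4), (2, 4), (1, 4), (48, 2), (40, 2), (36, 2), (34, 2),
    (33, 2), (24, 2), (20, 2), (18, 2), (17, 2), (12, 2), (10, 2), (9, 2), (6, 2), (5, 2), (3, 2)]

theorem bitCols_spec : ∀ x ∈ bitCols, ∀ m < 64, x.2.testBit m = true →
    m = m ||| x.1 ∧ m = (m - x.1) ||| x.1 := by decide +kernel

theorem bitCols_lt : ∀ x ∈ bitCols, x.2 < 2 ^ 64 := by decide +kernel

theorem lt_of_testBit {M k m : ℕ} (hM : M < 2 ^ k) (h : M.testBit m = true) : m < k := by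
  by_contra hc
  have : M < 2 ^ m := lt_of_lt_of_le hM (Nat.pow_le_pow_right (by norm_num) (not_lt.mp hc))
  simp [Nat.testBit_lt_two_pow this] at h

/-- The bits of `h` listed in `l`. -/
def chosen (h : ℕ) : List (ℕ × ℕ) → ℕ
  | [] => 0
  | (b, _) :: l => bif Nat.beq (Nat.land h b) 0 then chosen h l else b ||| chosen h l

theorem orShiftAux_spec (h : ℕ) (l : List (ℕ × ℕ)) (hl : ∀ x ∈ l, x ∈ bitCols) (F m : ℕ)
    (hm : (orShiftAux h l F).testBit m = true) :
    ∃ x, F.testBit x = true ∧ m = x ||| chosen h l := by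
  induction l generalizing F with
  | nil => exact ⟨m, hm, by simp [chosen]⟩
  | cons bM l ih =>
    obtain ⟨b, M⟩ := bM
    have hl' : ∀ x ∈ l, x ∈ bitCols := fun x hx => hl x (List.mem_cons_of_mem _ hx)
    cases hb : Nat.beq (Nat.land h b) 0 with
    | true =>
      simp only [orShiftAux, chosen, hb, cond_true] at hm ⊢
      exact ih hl' F hm
    | false =>
      simp only [orShiftAux, chosen, hb, cond_false, force_eq] at hm ⊢
      obtain ⟨x, hx, rfl⟩ := ih hl' _ hm
      have hx' : ((F ||| (F <<< b)) &&& M).testBit x = true := hx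
      rw [Nat.testBit_and, Nat.testBit_or, Nat.testBit_shiftLeft] at hx'
      simp only [Bool.and_eq_true, Bool.or_eq_true, decide_eq_true_eq] at hx'
      have hmem := hl (b, M) List.mem_cons_self
      obtain ⟨h1, h3⟩ := bitCols_spec _ hmem x (lt_of_testBit (bitCols_lt _ hmem) hx'.2) hx'.2
      simp only at h1 h3
      rcases hx'.1 with h0 | h0
      · refine ⟨x, h0, ?_⟩
        rw [← Nat.or_assoc, ← h1]
      · refine ⟨x - b, h0.2, ?_⟩
        rw [← Nat.or_assoc, ← h3]

theorem chosen_bitCols : ∀ h < 64, chosen h bitCols = h := by decide +kernel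

theorem orShift_spec {h F m : ℕ} (hh : h < 64) (hm : (orShift h F).testBit m = true) :
    ∃ x, F.testBit x = true ∧ m = x ||| h := by
  have := orShiftAux_spec h bitCols (fun _ hx => hx) F m hm
  rwa [chosen_bitCols h hh] at this

theorem genBits_spec {A : List ℕ} (hA : ∀ a ∈ A, a < 64) {Q : ℕ → Prop} (h0 : Q 0)
    (hQ : ∀ a ∈ A, ∀ x, Q x → Q (x ||| a)) (g : ℕ) (hg : (genBits A).testBit g = true) : Q g := by
  induction A generalizing g with
  | nil =>
    have : g = 0 := by
      by_contra h
      have : (1 : ℕ).testBit g = true := hg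
      rw [Nat.testBit_one_eq_true_iff_self_eq_zero] at this
      exact h this
    exact this ▸ h0
  | cons a A ih =>
    have ih' := ih (fun x hx => hA x (List.mem_cons_of_mem _ hx))
      (fun x hx => hQ x (List.mem_cons_of_mem _ hx))
    have hg' : (genBits A ||| orShift a (genBits A)).testBit g = true := hg
    rw [Nat.testBit_or, Bool.or_eq_true] at hg'
    rcases hg' with h | h
    · exact ih' g h
    · obtain ⟨x, hx, rfl⟩ := orShift_spec (hA a List.mem_cons_self) h
      exact hQ a List.mem_cons_self x (ih' x hx)

theorem negBits_spec (neg : List (ℕ × ℕ)) (m : ℕ) :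
    (negBits neg).testBit m = true ↔ m ∈ neg.map (·.1) := by
  induction neg with
  | nil => simp [negBits]
  | cons a l ih =>
    have : negBits (a :: l) = negBits l ||| 1 <<< a.1 := rfl
    rw [this, Nat.testBit_or, Bool.or_eq_true, ih, Nat.one_shiftLeft, Nat.testBit_two_pow]
    simp [or_comm, eq_comm]

theorem shiftRight_land_one (P i : ℕ) :
    Nat.land (Nat.shiftRight P i) 1 = if P.testBit i then 1 else 0 := by
  have h : Nat.land (Nat.shiftRight P i) 1 = (P >>> i) &&& 1 := rfl
  rw [h, Nat.and_one_is_mod, Nat.testBit_eq_decide_div_mod_eq, Nat.shiftRight_eq_div_pow]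
  rcases Nat.mod_two_eq_zero_or_one (P / 2 ^ i) with h | h <;> simp [h]

theorem score_eq (l : List (ℕ × ℕ)) (P : ℕ) (X : Finset ℕ)
    (hl : ∀ x ∈ l, x.1 ∈ X ↔ P.testBit x.1 = true) :
    score l P = ∑ m ∈ X, tab l m := by
  induction l with
  | nil => simp [score, tab]
  | cons a l ih =>
    have e : score (a :: l) P = Nat.land (Nat.shiftRight P a.1) 1 * a.2 + score l P := rfl
    have e2 : ∀ m, tab (a :: l) m = (if a.1 = m then a.2 else 0) + tab l m := by
      intro m
      by_cases h : a.1 = m <;> simp [tab, h]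
    simp only [e2, Finset.sum_add_distrib]
    rw [e, ih fun x hx => hl x (List.mem_cons_of_mem _ hx), shiftRight_land_one,
      Finset.sum_ite_eq]
    have := hl a List.mem_cons_self
    by_cases h : P.testBit a.1 = true <;> simp [h, this]

theorem tab_eq_zero {l : List (ℕ × ℕ)} {m : ℕ} (h : m ∉ l.map (·.1)) : tab l m = 0 := by
  have : l.filter (fun x => x.1 = m) = [] := by
    rw [List.filter_eq_nil_iff]
    intro x hx hxm
    exact h (List.mem_map.2 ⟨x, hx, by simpa using hxm⟩)
  simp [tab, this]

/-- A family of masks `B` whose negative members all lie in `P`, where `P` adds only negative masks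
to members of `B`, weighs at least as much as `P`. -/
theorem sum_nonneg_of_score {pos neg : List (ℕ × ℕ)} {B : Finset ℕ} {P : ℕ}
    (hB : ∀ m ∈ B, (tab pos m : ℤ) - tab neg m < 0 → P.testBit m = true)
    (hP : ∀ m, P.testBit m = true → m ∈ B ∨ (tab pos m : ℤ) - tab neg m < 0)
    (hs : score neg P ≤ score pos P) :
    0 ≤ ∑ m ∈ B, ((tab pos m : ℤ) - tab neg m) := by
  set X : Finset ℕ := (Finset.range (P + 1)).filter fun m => P.testBit m = true with hX
  have memX : ∀ m, m ∈ X ↔ P.testBit m = true := by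
    intro m
    simp only [hX, Finset.mem_filter, Finset.mem_range, and_iff_right_iff_imp]
    intro h
    have := Nat.ge_two_pow_of_testBit h
    have := Nat.lt_two_pow_self (n := m)
    omega
  rw [score_eq neg P X fun x _ => memX x.1, score_eq pos P X fun x _ => memX x.1] at hs
  have h0 : 0 ≤ ∑ m ∈ X, ((tab pos m : ℤ) - tab neg m) := by
    rw [Finset.sum_sub_distrib]
    have : ((∑ m ∈ X, tab neg m : ℕ) : ℤ) ≤ ((∑ m ∈ X, tab pos m : ℕ) : ℤ) := by
      exact_mod_cast hs
    push_cast at this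
    linarith
  have h1 : ∑ m ∈ X, ((tab pos m : ℤ) - tab neg m)
      ≤ ∑ m ∈ X ∩ B, ((tab pos m : ℤ) - tab neg m) := by
    rw [← Finset.sum_inter_add_sum_sdiff X B]
    have : ∑ m ∈ X \ B, ((tab pos m : ℤ) - tab neg m) ≤ 0 := by
      refine Finset.sum_nonpos fun m hm => ?_
      rw [Finset.mem_sdiff, memX] at hm
      exact ((hP m hm.1).resolve_left hm.2).le
    linarith
  have h2 : ∑ m ∈ X ∩ B, ((tab pos m : ℤ) - tab neg m)
      ≤ ∑ m ∈ B, ((tab pos m : ℤ) - tab neg m) := by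
    refine Finset.sum_le_sum_of_subset_of_nonneg Finset.inter_subset_right fun m hm hn => ?_
    by_contra hc
    exact hn (Finset.mem_inter.2 ⟨(memX m).2 (hB m hm (not_le.mp hc)), hm⟩)
  linarith

theorem search_sound {pos neg : List (ℕ × ℕ)} {G : ℕ} {B : Finset ℕ}
    (hU : ∀ x ∈ B, ∀ y ∈ B, x ||| y ∈ B)
    (hG : ∀ g, G.testBit g = true → ∀ x ∈ B, g ||| x ∈ B) (L : List (ℕ × ℕ))
    (hL : ∀ x ∈ L, (tab pos x.1 : ℤ) - tab neg x.1 < 0 ∧ x.1 < 64) (F P : ℕ)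
    (hF : ∀ m, F.testBit m = true → m ∈ B)
    (hB : ∀ m ∈ B, (tab pos m : ℤ) - tab neg m < 0 → P.testBit m = true)
    (hP : ∀ m, P.testBit m = true → m ∈ B ∨ (tab pos m : ℤ) - tab neg m < 0)
    (hs : search pos neg G L F P = true) :
    0 ≤ ∑ m ∈ B, ((tab pos m : ℤ) - tab neg m) := by
  induction L generalizing F P with
  | nil => exact sum_nonneg_of_score hB hP (Nat.le_of_ble_eq_true hs)
  | cons h t ih =>
    have ih' := ih fun x hx => hL x (List.mem_cons_of_mem _ hx)
    obtain ⟨hneg, h64⟩ := hL h List.mem_cons_self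
    unfold search at hs
    cases hb : Nat.ble (score neg P) (score pos P) with
    | true => exact sum_nonneg_of_score hB hP (Nat.le_of_ble_eq_true hb)
    | false =>
      rw [hb, cond_false] at hs
      cases hm : Nat.beq (Nat.land (Nat.shiftRight F h.1) 1) 0 with
      | false =>
        rw [hm, cond_false] at hs
        exact ih' F P hF hB hP hs
      | true =>
        rw [hm, cond_true, Bool.and_eq_true] at hs
        simp only [force_eq] at hs
        by_cases hh : h.1 ∈ B
        · have key : ∀ m, (Nat.lor F (orShift h.1 (Nat.lor F G))).testBit m = true → m ∈ B := by
            intro m hm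
            have hm' : (F ||| orShift h.1 (F ||| G)).testBit m = true := hm
            rw [Nat.testBit_or, Bool.or_eq_true] at hm'
            rcases hm' with h1 | h1
            · exact hF m h1
            · obtain ⟨x, hx, rfl⟩ := orShift_spec h64 h1
              rw [Nat.testBit_or, Bool.or_eq_true] at hx
              rcases hx with h2 | h2
              · exact hU x (hF x h2) _ hh
              · exact hG x h2 _ hh
          refine ih' _ _ key ?_ ?_ hs.2
          · intro m hm hw
            exact (Nat.testBit_or ..).trans (by rw [hB m hm hw]; rfl)
          · intro m hm
            have hm' := (Nat.testBit_or ..).symm.trans hm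
            rw [Bool.or_eq_true] at hm'
            exact hm'.elim (hP m) fun h => Or.inl (key m h)
        · have e : ∀ m, (Nat.xor P (Nat.shiftLeft 1 h.1)).testBit m
              = (P.testBit m ^^ decide (h.1 = m)) := by
            intro m
            have : Nat.xor P (Nat.shiftLeft 1 h.1) = P ^^^ (1 <<< h.1) := rfl
            rw [this, Nat.testBit_xor, Nat.one_shiftLeft, Nat.testBit_two_pow]
          refine ih' F _ hF ?_ ?_ hs.1
          · intro m hm hw
            have : h.1 ≠ m := fun h' => hh (h' ▸ hm)
            rw [e, hB m hm hw]
            simp [this]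
          · intro m hm
            by_cases h' : h.1 = m
            · exact Or.inr (h' ▸ hneg)
            · rw [e] at hm
              exact hP m (by simpa [h'] using hm)

theorem Data.sum_signed_nonneg {d : Data} (hd : d.Valid) (hc : d.check = true) {B : Finset ℕ}
    (hn : ∀ m ∈ B, m < 2 ^ d.n) (hU : ∀ x ∈ B, ∀ y ∈ B, x ||| y ∈ B)
    (hA : ∀ a ∈ d.A, ∀ x ∈ B, a ||| x ∈ B) : 0 ≤ ∑ m ∈ B, signed d.n d.c m := by
  obtain ⟨h6, -, -, hA64, hneg, hw⟩ := hd
  have hpow : 2 ^ d.n ≤ 2 ^ 6 := Nat.pow_le_pow_right (by norm_num) h6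
  have hA' : ∀ a ∈ d.A, a < 64 := fun a ha => lt_of_lt_of_le (hA64 a ha) hpow
  have hG := genBits_spec hA' (Q := fun g => ∀ x ∈ B, g ||| x ∈ B) (by simp)
    (fun a ha g hg x hx => by
      rw [Nat.or_assoc]
      exact hg _ (hA a ha x hx))
  rw [← Finset.sum_congr rfl fun m hm => hw m (hn m hm)]
  simp only [Data.check, force_eq] at hc
  refine search_sound hU hG d.neg hneg 0 _ (by simp) ?_ ?_ hc
  · intro m _ hm
    rw [negBits_spec]
    by_contra h
    rw [tab_eq_zero h] at hm
    simp at hm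
    omega
  · intro m hm
    obtain ⟨x, hx, rfl⟩ := List.mem_map.1 ((negBits_spec _ _).1 hm)
    exact Or.inr (hneg x hx).1

/-- The points `p i` for `i` in the mask `m`. -/
def img (n : ℕ) (p : ℕ → ℕ) (m : ℕ) : Finset ℕ :=
  ((Finset.range n).filter fun i => m.testBit i = true).image p

theorem mem_img_iff {n : ℕ} {p : ℕ → ℕ} (hp : ∀ i < n, ∀ j < n, p i = p j → i = j) {i m : ℕ}
    (hi : i < n) : p i ∈ img n p m ↔ m.testBit i = true := by
  simp only [img, Finset.mem_image, Finset.mem_filter, Finset.mem_range]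
  constructor
  · rintro ⟨j, ⟨hj, hm⟩, h⟩
    exact hp j hj i hi h ▸ hm
  · exact fun h => ⟨i, ⟨hi, h⟩, rfl⟩

theorem img_or (n : ℕ) (p : ℕ → ℕ) (x y : ℕ) : img n p (x ||| y) = img n p x ∪ img n p y := by
  simp only [img, ← Finset.image_union, ← Finset.filter_or, Nat.testBit_or, Bool.or_eq_true]

theorem exists_img_eq (n : ℕ) (p : ℕ → ℕ) (S : Finset ℕ) :
    ∃ m < 2 ^ n, img n p m ∪ S \ (Finset.range n).image p = S := by
  refine ⟨Nat.ofBits fun i : Fin n => decide (p i ∈ S), Nat.ofBits_lt_two_pow _, ?_⟩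
  ext x
  simp only [img, Finset.mem_union, Finset.mem_image, Finset.mem_filter, Finset.mem_range,
    Finset.mem_sdiff]
  constructor
  · rintro (⟨i, ⟨hi, h⟩, rfl⟩ | h)
    · rw [Nat.testBit_ofBits_lt _ _ hi] at h
      simpa using h
    · exact h.1
  · intro hx
    by_cases h : ∃ i < n, p i = x
    · obtain ⟨i, hi, rfl⟩ := h
      exact Or.inl ⟨i, ⟨hi, by rw [Nat.testBit_ofBits_lt _ _ hi]; simpa using hx⟩, rfl⟩
    · exact Or.inr ⟨hx, h⟩

theorem sum_indicator_eq (F : Finset (Finset ℕ)) (x : ℕ) :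
    ∑ S ∈ F, (if x ∈ S then 1 else -1 : ℤ) = 2 * (memFam F x).card - F.card := by
  have h : ∀ S : Finset ℕ, (if x ∈ S then 1 else -1 : ℤ) = 2 * (if x ∈ S then 1 else 0) - 1 := by
    intro S
    split_ifs <;> norm_num
  simp only [h, Finset.sum_sub_distrib, ← Finset.mul_sum, Finset.sum_boole]
  simp [memFam]

/-- A family containing a copy of a configuration passing the check has an abundant point in it. -/
theorem Data.exists_abundant {d : Data} (hd : d.Valid) (hc : d.check = true) {p : ℕ → ℕ}
    (hp : ∀ i < d.n, ∀ j < d.n, p i = p j → i = j) {F : Finset (Finset ℕ)} (hF : UC F)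
    (hA : ∀ a ∈ d.A, img d.n p a ∈ F) : ∃ i < d.n, F.card ≤ 2 * (memFam F (p i)).card := by
  set V := (Finset.range d.n).image p with hV
  have memV : ∀ i < d.n, p i ∈ V := fun i hi =>
    Finset.mem_image_of_mem _ (Finset.mem_range.2 hi)
  have imgV : ∀ m, img d.n p m ⊆ V := fun m => Finset.image_subset_image (Finset.filter_subset _ _)
  let ω : Finset ℕ → ℤ := fun S =>
    ∑ i ∈ Finset.range d.n, (d.c.getD i 0 : ℤ) * (if p i ∈ S then 1 else -1)
  have hω : 0 ≤ ∑ S ∈ F, ω S := by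
    rw [← Finset.sum_fiberwise_of_maps_to (t := F.image (· \ V)) (g := (· \ V))
      fun S hS => Finset.mem_image_of_mem _ hS]
    refine Finset.sum_nonneg fun T hT => ?_
    obtain ⟨S₀, -, rfl⟩ := Finset.mem_image.1 hT
    set T := S₀ \ V
    have hTV : Disjoint T V := Finset.sdiff_disjoint
    have hpT : ∀ i < d.n, p i ∉ T := fun i hi h => Finset.disjoint_left.1 hTV h (memV i hi)
    have key : ∀ i < d.n, ∀ m, p i ∈ img d.n p m ∪ T ↔ m.testBit i = true := by
      intro i hi m
      rw [Finset.mem_union, mem_img_iff hp hi, or_iff_left (hpT i hi)]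
    let B := (Finset.range (2 ^ d.n)).filter fun m => img d.n p m ∪ T ∈ F
    have memB : ∀ m, m ∈ B ↔ m < 2 ^ d.n ∧ img d.n p m ∪ T ∈ F := fun m => by simp [B]
    have hB : ∑ m ∈ B, signed d.n d.c m = ∑ S ∈ F with S \ V = T, ω S := by
      refine Finset.sum_bij (fun m _ => img d.n p m ∪ T) ?_ ?_ ?_ ?_
      · intro m hm
        refine Finset.mem_filter.2 ⟨((memB m).1 hm).2, ?_⟩
        rw [Finset.union_sdiff_distrib, Finset.sdiff_eq_empty_iff_subset.2 (imgV m),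
          Finset.empty_union, Finset.sdiff_eq_self_of_disjoint hTV]
      · intro m hm m' hm' h
        refine Nat.eq_of_testBit_eq fun i => ?_
        by_cases hi : i < d.n
        · rw [Bool.eq_iff_iff, ← key i hi, ← key i hi, h]
        · have hpow : 2 ^ d.n ≤ 2 ^ i := Nat.pow_le_pow_right (by norm_num) (not_lt.mp hi)
          rw [Nat.testBit_lt_two_pow (((memB m).1 hm).1.trans_le hpow),
            Nat.testBit_lt_two_pow (((memB m').1 hm').1.trans_le hpow)]
      · intro S hS
        obtain ⟨hS, hST⟩ := Finset.mem_filter.1 hS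
        obtain ⟨m, hm, h⟩ := exists_img_eq d.n p S
        rw [← hV, hST] at h
        exact ⟨m, (memB m).2 ⟨hm, h ▸ hS⟩, h⟩
      · intro m _
        refine Finset.sum_congr rfl fun i hi => ?_
        simp only [key i (Finset.mem_range.1 hi) m]
    rw [← hB]
    refine Data.sum_signed_nonneg hd hc (fun m hm => ((memB m).1 hm).1) ?_ ?_
    · intro x hx y hy
      rw [memB] at hx hy ⊢
      refine ⟨Nat.or_lt_two_pow hx.1 hy.1, ?_⟩
      have := hF _ hx.2 _ hy.2
      rwa [Finset.union_union_union_comm, Finset.union_self, ← img_or] at this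
    · intro a ha x hx
      rw [memB] at hx ⊢
      refine ⟨Nat.or_lt_two_pow (hd.2.2.2.1 a ha) hx.1, ?_⟩
      have := hF _ (hA a ha) _ hx.2
      rwa [← Finset.union_assoc, ← img_or] at this
  by_contra! hcon
  have hlt : ∑ S ∈ F, ω S < 0 := by
    rw [Finset.sum_comm]
    simp only [← Finset.mul_sum, sum_indicator_eq]
    refine Finset.sum_neg (fun i hi => ?_) ⟨0, Finset.mem_range.2 hd.2.1⟩
    have hi := Finset.mem_range.1 hi
    have h1 := hd.2.2.1 i hi
    have h2 := hcon i hi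
    exact mul_neg_of_pos_of_neg (by exact_mod_cast h1) (by zify at h2; linarith)
  exact absurd hω (not_le.2 hlt)

/-- The masks of the 3-subsets. -/
def triples : List ℕ :=
  [7, 11, 13, 14, 19, 21, 22, 25, 26, 28, 35, 37, 38, 41, 42, 44, 49, 50, 52, 56]

/-- The subset of `{1, …, 6}` with mask `m`. -/
def decode (m : ℕ) : Finset ℕ := img 6 (· + 1) m

/-- `p` is a copy of the configuration `d` among the sets with masks `ms`. -/
def IsCopy (d : Data) (ms : List ℕ) (p : ℕ → ℕ) : Prop :=
  (∀ i < d.n, ∀ j < d.n, p i = p j → i = j) ∧ ∀ a ∈ d.A, ∃ m ∈ ms, img d.n p a = decode m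

instance (d : Data) (ms : List ℕ) (p : ℕ → ℕ) : Decidable (IsCopy d ms p) := by
  unfold IsCopy; infer_instance

/-- `List.any` by direct recursion, for the kernel. -/
def anyRec (f : ℕ → Bool) (l : List ℕ) : Bool :=
  List.rec (motive := fun _ => Bool) false (fun x _ b => bif f x then true else b) l

theorem anyRec_eq (f : ℕ → Bool) (l : List ℕ) : anyRec f l = l.any f := by
  induction l with
  | nil => rfl
  | cons x l ih =>
    have : anyRec f (x :: l) = bif f x then true else anyRec f l := rfl
    rw [this, ih, List.any_cons]
    cases f x <;> rfl

/-- Entry `i` of a list packed into a number, six bits for each entry. -/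
def entry (l i : ℕ) : ℕ := Nat.land (Nat.shiftRight l (Nat.mul 6 i)) 63

/-- Place the points of `d` one after the other. The first `k` points, as masks of singletons, are
packed into `l`, and `used` is their union. An entry `(i, j)` of the plan asks for the triple made of
the points numbered `i`, `j` and the current one. -/
def findCopy (d : Data) (ms : List ℕ) (fam : ℕ) :
    List (List (ℕ × ℕ)) → ℕ → ℕ → ℕ → Bool
  | [], _, _, l => decide (IsCopy d ms fun i => Nat.log2 (entry l i) + 1)
  | c :: plan, k, used, l => anyRec (fun x =>
      Nat.beq (Nat.land used x) 0 &&
      c.all (fun ij => Nat.beq (Nat.land (Nat.shiftRight fam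
        (Nat.lor (entry l ij.1) (Nat.lor (entry l ij.2) x))) 1) 1) &&
      force (Nat.lor used x) fun used' =>
        force (Nat.lor l (Nat.shiftLeft x (Nat.mul 6 k))) (findCopy d ms fam plan (Nat.succ k) used'))
    [1, 2, 4, 8, 16, 32]

theorem findCopy_sound {d : Data} {ms : List ℕ} {fam k used l : ℕ} {plan : List (List (ℕ × ℕ))}
    (h : findCopy d ms fam plan k used l = true) : ∃ p, IsCopy d ms p := by
  induction plan generalizing k used l with
  | nil => exact ⟨_, of_decide_eq_true h⟩
  | cons c plan ih =>
    rw [findCopy, anyRec_eq] at h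
    obtain ⟨x, -, hx⟩ := List.any_eq_true.1 h
    have := (Bool.and_eq_true_iff.1 hx).2
    simp only [force_eq] at this
    exact ih this

/-- The family with members `ms`. -/
def famBits (ms : List ℕ) : ℕ := ms.foldr (fun m F => Nat.lor (Nat.shiftLeft 1 m) F) 0

/-- The sets with masks `ms` contain one of the configurations of three triples. -/
def hasCopy₃ (ms : List ℕ) : Bool :=
  force (famBits ms) fun fam =>
    findCopy pathData ms fam [[], [], [(0, 1)], [(1, 2)], [(2, 3)]] 0 0 0 ||
    findCopy forkData ms fam [[], [], [(0, 1)], [(0, 1)], [(2, 3)]] 0 0 0 ||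
    findCopy starData ms fam [[], [], [(0, 1)], [(0, 1), (0, 2)]] 0 0 0 ||
    findCopy sunflowerData ms fam [[], [], [(0, 1)], [(0, 1)], [(0, 1)]] 0 0 0

/-- The sets with masks `ms` contain one of the configurations of four triples. -/
def hasCopy₄ (ms : List ℕ) : Bool :=
  force (famBits ms) fun fam =>
    findCopy tetraData ms fam [[], [], [(0, 1)], [], [(0, 3)], [(1, 3), (2, 4)]] 0 0 0 ||
    findCopy cycleData ms fam [[], [], [(0, 1)], [(0, 1)], [], [(2, 4), (3, 4)]] 0 0 0

/-- The union of the three masks is everything. -/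
def spans (a b c : ℕ) : Bool := Nat.beq (Nat.lor a (Nat.lor b c)) 63

/-- Three triples that do not span form a copy of a configuration. -/
def check₃ : Bool :=
  triples.all fun a => triples.all fun b => Nat.ble b a || triples.all fun c => Nat.ble c b ||
    spans a b c || hasCopy₃ [a, b, c]

/-- Four triples any three of which span form a copy of a configuration. -/
def check₄ : Bool :=
  triples.all fun a => triples.all fun b => Nat.ble b a || triples.all fun c => Nat.ble c b ||
    !spans a b c || triples.all fun d => Nat.ble d c || !spans a b d || !spans a c d ||
      !spans b c d || hasCopy₄ [a, b, c, d]

set_option maxRecDepth 100000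
theorem star_check : starData.check = true := by decide +kernel
theorem sunflower_check : sunflowerData.check = true := by decide +kernel
theorem path_check : pathData.check = true := by decide +kernel
theorem fork_check : forkData.check = true := by decide +kernel
theorem tetra_check : tetraData.check = true := by decide +kernel
theorem cycle_check : cycleData.check = true := by decide +kernel
theorem star_valid : starData.Valid := by decide +kernel
theorem sunflower_valid : sunflowerData.Valid := by decide +kernel
theorem path_valid : pathData.Valid := by decide +kernel
theorem fork_valid : forkData.Valid := by decide +kernel
theorem tetra_valid : tetraData.Valid := by decide +kernel
theorem cycle_valid : cycleData.Valid := by decide +kernel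

theorem check₃_eq : check₃ = true := by decide +kernel
theorem check₄_eq : check₄ = true := by decide +kernel

/-- The sets with masks `ms` contain a copy of a configuration passing the check. -/
def Good (ms : List ℕ) : Prop :=
  ∃ d : Data, d.Valid ∧ d.check = true ∧ (∀ i < d.n, ∃ a ∈ d.A, a.testBit i = true) ∧
    ∃ p, IsCopy d ms p

theorem Good.mono {ms ms' : List ℕ} (h : Good ms) (hs : ms ⊆ ms') : Good ms' := by
  obtain ⟨d, h1, h2, h3, p, h4, h5⟩ := h
  refine ⟨d, h1, h2, h3, p, h4, fun a ha => ?_⟩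
  obtain ⟨m, hm, e⟩ := h5 a ha
  exact ⟨m, hs hm, e⟩

theorem good_of_hasCopy₃ {ms : List ℕ} (h : hasCopy₃ ms = true) : Good ms := by
  simp only [hasCopy₃, force_eq, Bool.or_eq_true, or_assoc] at h
  rcases h with h | h | h | h
  · exact ⟨_, path_valid, path_check, by decide, findCopy_sound h⟩
  · exact ⟨_, fork_valid, fork_check, by decide, findCopy_sound h⟩
  · exact ⟨_, star_valid, star_check, by decide, findCopy_sound h⟩
  · exact ⟨_, sunflower_valid, sunflower_check, by decide, findCopy_sound h⟩

theorem good_of_hasCopy₄ {ms : List ℕ} (h : hasCopy₄ ms = true) : Good ms := by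
  simp only [hasCopy₄, force_eq, Bool.or_eq_true] at h
  rcases h with h | h
  · exact ⟨_, tetra_valid, tetra_check, by decide, findCopy_sound h⟩
  · exact ⟨_, cycle_valid, cycle_check, by decide, findCopy_sound h⟩

theorem good_of_not_spans {a b c : ℕ} (ha : a ∈ triples) (hb : b ∈ triples) (hc : c ∈ triples)
    (hab : a < b) (hbc : b < c) (h : spans a b c = false) : Good [a, b, c] := by
  have := check₃_eq
  simp only [check₃, List.all_eq_true, Bool.or_eq_true] at this
  have h1 := (this a ha b hb).resolve_left fun h => by have := Nat.le_of_ble_eq_true h; omega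
  have h2 := h1 c hc
  rw [h] at h2
  simp only [Bool.false_eq_true, or_false] at h2
  exact good_of_hasCopy₃ (h2.resolve_left fun h => by have := Nat.le_of_ble_eq_true h; omega)

theorem good_four {a b c d : ℕ} (ha : a ∈ triples) (hb : b ∈ triples) (hc : c ∈ triples)
    (hd : d ∈ triples) (hab : a < b) (hbc : b < c) (hcd : c < d) : Good [a, b, c, d] := by
  cases h1 : spans a b c with
  | false => exact (good_of_not_spans ha hb hc hab hbc h1).mono (by simp)
  | true =>
  cases h2 : spans a b d with
  | false => exact (good_of_not_spans ha hb hd hab (hbc.trans hcd) h2).mono (by simp)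
  | true =>
  cases h3 : spans a c d with
  | false => exact (good_of_not_spans ha hc hd (hab.trans hbc) hcd h3).mono (by simp)
  | true =>
  cases h4 : spans b c d with
  | false => exact (good_of_not_spans hb hc hd hbc hcd h4).mono (by simp)
  | true =>
  have := check₄_eq
  simp only [check₄, List.all_eq_true, Bool.or_eq_true, or_assoc] at this
  have h5 := (this a ha b hb).resolve_left fun h => by have := Nat.le_of_ble_eq_true h; omega
  have h6 := (h5 c hc).resolve_left fun h => by have := Nat.le_of_ble_eq_true h; omega
  have h7 := (h6.resolve_left (by simp [h1]) d hd).resolve_left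
    fun h => by have := Nat.le_of_ble_eq_true h; omega
  simp only [h2, h3, h4, Bool.not_true, Bool.false_eq_true, false_or] at h7
  exact good_of_hasCopy₄ h7

theorem decode_surj : ∀ s ∈ (Finset.Icc 1 6).powersetCard 3, ∃ m ∈ triples, decode m = s := by
  decide +kernel

theorem self_subset_gen (S : Finset (Finset ℕ)) : S ⊆ gen S := by
  intro s hs
  refine Finset.mem_image.2 ⟨{s}, ?_, by simp⟩
  simp [hs]

theorem FC_gen_of_card_eq_four (S : Finset (Finset ℕ))
    (hS : S ⊆ (Finset.Icc 1 6).powersetCard 3) (h4 : S.card = 4) : FC (gen S) := by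
  set Q := triples.toFinset.filter fun m => decode m ∈ S with hQ
  have hSQ : S ⊆ Q.image decode := by
    intro s hs
    obtain ⟨m, hm, rfl⟩ := decode_surj s (hS hs)
    exact Finset.mem_image_of_mem _ (by simp [hQ, hm, hs])
  have hcard : 4 ≤ Q.card := h4 ▸ (Finset.card_le_card hSQ).trans Finset.card_image_le
  obtain ⟨R, hRQ, hR⟩ := Finset.exists_subset_card_eq hcard
  let e := R.orderEmbOfFin hR
  have he : ∀ i, e i ∈ triples ∧ decode (e i) ∈ S := fun i => by
    simpa [hQ] using hRQ (R.orderEmbOfFin_mem hR i)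
  obtain ⟨d, hd, hc, hcov, p, hp, hA⟩ := good_four (he 0).1 (he 1).1 (he 2).1 (he 3).1
    (e.strictMono (by decide)) (e.strictMono (by decide)) (e.strictMono (by decide))
  have hAS : ∀ a ∈ d.A, img d.n p a ∈ S := by
    intro a ha
    obtain ⟨m, hm, h⟩ := hA a ha
    simp only [List.mem_cons, List.not_mem_nil, or_false] at hm
    rw [h]
    rcases hm with rfl | rfl | rfl | rfl <;> exact (he _).2
  intro F hF hgF
  obtain ⟨i, hi, h⟩ := Data.exists_abundant hd hc hp hF fun a ha =>
    hgF (self_subset_gen S (hAS a ha))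
  obtain ⟨a, ha, hai⟩ := hcov i hi
  refine ⟨p i, ?_, h⟩
  have hle : img d.n p a ≤ famU (gen S) :=
    Finset.le_sup (f := id) (self_subset_gen S (hAS a ha))
  exact hle ((mem_img_iff hp hi).2 hai)

/-- Three 3-subsets of `{1, …, 6}` that generate a Non-FC family. -/
def threeTriples : Finset (Finset ℕ) := {{1, 2, 3}, {1, 2, 4}, {3, 5, 6}}

/-- The condition defining the `j`-th level of the counterexample. -/
def levelCond (j : ℕ) (S : Finset ℕ) : Prop :=
  if j = 0 then S ∈ gen threeTriples
  else if j = 1 then True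
  else if j < 16 then 2 ∈ S → 1 ∈ S ∧ (3 ∈ S ∨ 4 ∈ S)
  else if j < 30 then 1 ∈ S → 2 ∈ S ∧ (3 ∈ S ∨ 4 ∈ S)
  else if j < 41 then 3 ∈ S → (1 ∈ S ∧ 2 ∈ S) ∨ (5 ∈ S ∧ 6 ∈ S)
  else if j < 46 then 4 ∈ S → 1 ∈ S ∧ 2 ∈ S
  else if j < 51 then 6 ∈ S → 3 ∈ S ∧ 5 ∈ S
  else 5 ∈ S → 3 ∈ S ∧ 6 ∈ S

instance (j : ℕ) (S : Finset ℕ) : Decidable (levelCond j S) := by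
  unfold levelCond; infer_instance

/-- The traces on `{1, …, 6}` of the sets at level `j`. -/
def level (j : ℕ) : Finset (Finset ℕ) := (Finset.Icc 1 6).powerset.filter (levelCond j)

/-- The part outside `{1, …, 6}` of the sets at level `j`. -/
def outer (j : ℕ) : Finset ℕ := (Finset.Icc 7 60).filter fun x => j ≠ 0 ∧ x ≠ j + 5

/-- A union-closed family containing `gen threeTriples` in which `1, …, 6` are all rare. -/
def stackedFam : Finset (Finset ℕ) :=
  (Finset.range 56).biUnion fun j => (level j).image (· ∪ outer j)

theorem mem_outer {j x : ℕ} : x ∈ outer j ↔ (7 ≤ x ∧ x ≤ 60) ∧ j ≠ 0 ∧ x ≠ j + 5 := by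
  simp [outer]

theorem subset_of_mem_level {j : ℕ} {S : Finset ℕ} (h : S ∈ level j) : S ⊆ Finset.Icc 1 6 :=
  Finset.mem_powerset.1 (Finset.mem_filter.1 h).1

theorem mem_of_mem_level {j i : ℕ} {S : Finset ℕ} (h : S ∈ level j) :
    i ∈ S ↔ i ∈ S ∪ outer j ∧ i ≤ 6 := by
  have := @subset_of_mem_level j S h i
  simp only [Finset.mem_union, mem_outer]
  rw [Finset.mem_Icc] at this
  constructor
  · exact fun h => ⟨Or.inl h, (this h).2⟩
  · rintro ⟨h | h, h'⟩
    · exact h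
    · omega

theorem eq_of_union_outer_eq {j k : ℕ} {S S' : Finset ℕ} (hS : S ∈ level j) (hS' : S' ∈ level k)
    (h : S ∪ outer j = S' ∪ outer k) : S = S' := by
  ext i
  rw [mem_of_mem_level hS, mem_of_mem_level hS', h]

theorem level_eq_of_union_outer_eq {j k : ℕ} (hj : j < 56) (hk : k < 56) {S S' : Finset ℕ}
    (hS : S ∈ level j) (hS' : S' ∈ level k) (h : S ∪ outer j = S' ∪ outer k) : j = k := by
  have key : ∀ x, 7 ≤ x → (x ∈ outer j ↔ x ∈ outer k) := by
    intro x hx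
    have h1 : x ∉ S := fun hm => by
      have := Finset.mem_Icc.1 (subset_of_mem_level hS hm)
      omega
    have h2 : x ∉ S' := fun hm => by
      have := Finset.mem_Icc.1 (subset_of_mem_level hS' hm)
      omega
    have := Finset.ext_iff.1 h x
    simpa [h1, h2] using this
  simp only [mem_outer] at key
  by_contra hne
  have h7 := key 7 le_rfl
  have h8 := key 8 (by norm_num)
  have h9 := key 9 (by norm_num)
  have hj5 := key (j + 5)
  have hk5 := key (k + 5)
  omega

theorem sum_stackedFam (f : Finset ℕ → ℕ) :
    ∑ S ∈ stackedFam, f S = ∑ j ∈ Finset.range 56, ∑ S ∈ level j, f (S ∪ outer j) := by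
  rw [stackedFam, Finset.sum_biUnion]
  · refine Finset.sum_congr rfl fun j _ => Finset.sum_image ?_
    exact fun S hS S' hS' h => eq_of_union_outer_eq hS hS' h
  · intro j hj k hk hne
    refine Finset.disjoint_left.2 fun U hU hU' => hne ?_
    obtain ⟨S, hS, rfl⟩ := Finset.mem_image.1 hU
    obtain ⟨S', hS', h⟩ := Finset.mem_image.1 hU'
    exact level_eq_of_union_outer_eq (Finset.mem_range.1 hj) (Finset.mem_range.1 hk) hS hS' h.symm

theorem gen_threeTriples_subset_level : ∀ j < 56, gen threeTriples ⊆ level j := by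
  decide +kernel

theorem level_zero_union : ∀ S ∈ gen threeTriples, ∀ S' ∈ gen threeTriples,
    S ∪ S' ∈ gen threeTriples := by
  decide +kernel

theorem UC_level (j : ℕ) : UC (level j) := by
  intro S hS S' hS'
  have h1 := subset_of_mem_level hS
  have h2 := subset_of_mem_level hS'
  refine Finset.mem_filter.2 ⟨Finset.mem_powerset.2 (Finset.union_subset h1 h2), ?_⟩
  have h3 := (Finset.mem_filter.1 hS).2
  have h4 := (Finset.mem_filter.1 hS').2
  unfold levelCond at *
  split_ifs at *
  · exact level_zero_union S h3 S' h4
  all_goals simp only [Finset.mem_union]; tauto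

theorem mem_gen_of_mem_level_zero {S : Finset ℕ} (h : S ∈ level 0) : S ∈ gen threeTriples := by
  have := (Finset.mem_filter.1 h).2
  rwa [levelCond, if_pos rfl] at this

theorem mem_stackedFam {j : ℕ} (hj : j < 56) {S U : Finset ℕ} (hS : S ∈ level j)
    (hU : U = S ∪ outer j) : U ∈ stackedFam :=
  Finset.mem_biUnion.2 ⟨j, Finset.mem_range.2 hj, Finset.mem_image.2 ⟨S, hS, hU.symm⟩⟩

theorem UC_stackedFam : UC stackedFam := by
  intro U hU U' hU'
  obtain ⟨j, hj, hU⟩ := Finset.mem_biUnion.1 hU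
  obtain ⟨S, hS, rfl⟩ := Finset.mem_image.1 hU
  obtain ⟨k, hk, hU'⟩ := Finset.mem_biUnion.1 hU'
  obtain ⟨S', hS', rfl⟩ := Finset.mem_image.1 hU'
  rw [Finset.mem_range] at hj hk
  have hou : outer 0 = ∅ := by simp [outer]
  rw [Finset.union_union_union_comm]
  by_cases hjk : j = k
  · subst hjk
    exact mem_stackedFam hj (UC_level j S hS S' hS') (by rw [Finset.union_self])
  by_cases hj0 : j = 0
  · subst hj0
    have := gen_threeTriples_subset_level k hk (mem_gen_of_mem_level_zero hS)
    exact mem_stackedFam hk (UC_level k S this S' hS') (by rw [hou, Finset.empty_union])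
  by_cases hk0 : k = 0
  · subst hk0
    have := gen_threeTriples_subset_level j hj (mem_gen_of_mem_level_zero hS')
    exact mem_stackedFam hj (UC_level j S hS S' this) (by rw [hou, Finset.union_empty])
  · refine mem_stackedFam (j := 1) (S := S ∪ S') (by norm_num) ?_ ?_
    · refine Finset.mem_filter.2 ⟨Finset.mem_powerset.2 (Finset.union_subset
        (subset_of_mem_level hS) (subset_of_mem_level hS')), ?_⟩
      rw [levelCond, if_neg one_ne_zero, if_pos rfl]
      trivial
    · congr 1
      ext x
      simp only [Finset.mem_union, mem_outer]
      omega

theorem level_counts : ∀ i ∈ Finset.Icc 1 6,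
    2 * ∑ j ∈ Finset.range 56, (memFam (level j) i).card < ∑ j ∈ Finset.range 56, (level j).card := by
  decide +kernel

theorem famU_gen_threeTriples : famU (gen threeTriples) ⊆ Finset.Icc 1 6 := by
  decide +kernel

theorem NonFC_gen_threeTriples : NonFC (gen threeTriples) := by
  refine ⟨stackedFam, UC_stackedFam, fun S hS => ?_, fun i hi => ?_⟩
  · exact mem_stackedFam (j := 0) (by norm_num)
      (gen_threeTriples_subset_level 0 (by norm_num) hS) (by simp [outer])
  · have hi := famU_gen_threeTriples hi
    have h6 := (Finset.mem_Icc.1 hi).2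
    have h1 : (memFam stackedFam i).card = ∑ j ∈ Finset.range 56, (memFam (level j) i).card := by
      rw [memFam, Finset.card_filter, sum_stackedFam]
      refine Finset.sum_congr rfl fun j _ => ?_
      rw [memFam, Finset.card_filter]
      refine Finset.sum_congr rfl fun S hS => ?_
      have hiff : i ∈ S ∪ outer j ↔ i ∈ S :=
        ⟨fun h => (mem_of_mem_level hS).2 ⟨h, h6⟩, fun h => Finset.mem_union_left _ h⟩
      simp only [hiff]
    have h2 : stackedFam.card = ∑ j ∈ Finset.range 56, (level j).card := by
      rw [Finset.card_eq_sum_ones, sum_stackedFam]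
      simp
    rw [h1, h2]
    exact level_counts i hi

/-- FC(3,6) = 4. -/
theorem FC_3_6 :
    (∀ S : Finset (Finset ℕ), S ⊆ (Finset.Icc 1 6).powersetCard 3 → S.card = 4 →
      FC (gen S)) ∧
    (∃ S : Finset (Finset ℕ), S ⊆ (Finset.Icc 1 6).powersetCard 3 ∧ S.card = 3 ∧
      NonFC (gen S)) := by
  exact ⟨FC_gen_of_card_eq_four, threeTriples, by decide +kernel, by decide +kernel,
    NonFC_gen_threeTriples⟩
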